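/- For every δ > 0 there exists a constant c > 0 such that for every ℓ ∈ ℕ₀ and every n ≥ 1, (1/n) Σ_{x ∈ ℤ} f_ℓ(x/n)² ≤ 1 + c (1+ℓ)^{7/12+δ} / n, where f_ℓ is the ℓ-th Hermite function. -/

import Mathlib

/-- The ℓ-th Hermite function `f_ℓ(x) = (ℓ! √(2π))^{-1/2} H_ℓ(x) e^{-x²/4}`, where `H_ℓ` is the
probabilists' Hermite polynomial. -/
noncomputable def hermiteFun (ℓ : ℕ) (x : ℝ) : ℝ :=
  (Real.sqrt (ℓ.factorial * Real.sqrt (2 * Real.pi)))⁻¹ *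
    (Polynomial.aeval x (Polynomial.hermite ℓ)) * Real.exp (-x ^ 2 / 4)

open Polynomial MeasureTheory in
lemma gauss_poly_integrable (p : ℝ[X]) :
    Integrable (fun x : ℝ => p.eval x * Real.exp (-(1/2) * x ^ 2)) := by
  induction p using Polynomial.induction_on' with
  | add p q hp hq =>
    simp only [eval_add, add_mul]
    exact hp.add hq
  | monomial n a =>
    have h := integrable_rpow_mul_exp_neg_mul_sq (b := 1/2) (by norm_num) (s := n)
      (by have : (0:ℝ) ≤ n := Nat.cast_nonneg n
          linarith)
    simp only [Real.rpow_natCast] at h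
    simp only [eval_monomial, mul_assoc]
    exact h.const_mul a

open Polynomial in
lemma gauss_poly_hasDerivAt (p : ℝ[X]) (x : ℝ) :
    HasDerivAt (fun x : ℝ => p.eval x * Real.exp (-(1/2) * x ^ 2))
      ((derivative p - X * p).eval x * Real.exp (-(1/2) * x ^ 2)) x := by
  have h1 := p.hasDerivAt x
  have h2 : HasDerivAt (fun x : ℝ => Real.exp (-(1/2) * x ^ 2))
      (Real.exp (-(1/2) * x ^ 2) * (-(1/2) * (2 * x))) x := by
    have h3 : HasDerivAt (fun x : ℝ => -(1/2) * x ^ 2) (-(1/2) * (2 * x)) x := by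
      exact ((hasDerivAt_pow 2 x).const_mul (-(1/2))).congr_deriv (by norm_num)
    exact h3.exp
  refine (h1.mul h2).congr_deriv ?_
  simp only [eval_sub, eval_mul, eval_X]
  ring

open Polynomial MeasureTheory in
lemma gauss_poly_integral_zero (p : ℝ[X]) :
    ∫ x : ℝ, (derivative p - X * p).eval x * Real.exp (-(1/2) * x ^ 2) = 0 :=
  integral_eq_zero_of_hasDerivAt_of_integrable (gauss_poly_hasDerivAt p)
    (gauss_poly_integrable _) (gauss_poly_integrable _)

open Polynomial in
noncomputable def hermR (n : ℕ) : ℝ[X] := (hermite n).map (Int.castRingHom ℝ)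

open Polynomial in
lemma hermR_succ (n : ℕ) : hermR (n+1) = X * hermR n - derivative (hermR n) := by
  simp [hermR, derivative_map]

open Polynomial in
lemma hermR_deriv (n : ℕ) : derivative (hermR (n+1)) = ((n : ℝ[X]) + 1) * hermR n := by
  induction n with
  | zero => simp [hermR]
  | succ n ih =>
    rw [hermR_succ (n+1)]
    simp only [derivative_sub, derivative_mul, derivative_X, ih, derivative_add,
      derivative_natCast, derivative_one]
    rw [hermR_succ n]
    push_cast
    ring

open Polynomial MeasureTheory in
lemma hermR_norm (n : ℕ) : ∫ x : ℝ, ((hermR n) ^ 2).eval x * Real.exp (-(1/2) * x ^ 2)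
    = n.factorial * Real.sqrt (2 * Real.pi) := by
  induction n with
  | zero =>
    have := integral_gaussian (1/2)
    simp only [hermR, hermite_zero]
    simp only [map_one, Polynomial.map_one, one_pow, eval_one, one_mul, this]
    simp only [Nat.factorial_zero, Nat.cast_one, one_mul]
    congr 1
    ring
  | succ n ih =>
    have h0 := gauss_poly_integral_zero (hermR n * hermR (n+1))
    have e : derivative (hermR n * hermR (n+1)) - X * (hermR n * hermR (n+1))
       = C ((n:ℝ)+1) * hermR n ^ 2 - hermR (n+1) ^ 2 := by
      rw [derivative_mul, hermR_deriv]
      have := hermR_succ n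
      have h2 : derivative (hermR n) = X * hermR n - hermR (n+1) := by rw [this]; ring
      rw [h2]
      simp only [C_add, C_1, map_natCast]
      ring
    rw [e] at h0
    simp only [eval_sub, eval_mul (p := C _), eval_C, sub_mul] at h0
    simp only [mul_assoc ((n:ℝ)+1)] at h0
    rw [integral_sub ((gauss_poly_integrable _).const_mul _) (gauss_poly_integrable _),
      integral_const_mul, ih] at h0
    rw [Nat.factorial_succ]
    push_cast
    linarith

open Polynomial MeasureTheory in
lemma hermR_deriv_norm (n : ℕ) :
    ∫ x : ℝ, ((derivative (hermR n)) ^ 2).eval x * Real.exp (-(1/2) * x ^ 2)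
    = n * (n.factorial * Real.sqrt (2 * Real.pi)) := by
  cases n with
  | zero => simp [hermR]
  | succ n =>
    have e : derivative (hermR (n+1)) ^ 2 = C (((n:ℝ)+1)^2) * hermR n ^ 2 := by
      rw [hermR_deriv]
      simp only [C_pow, C_add, C_1, map_natCast]
      ring
    rw [e]
    simp only [eval_mul (p := C _), eval_C]
    simp only [mul_assoc (((n:ℝ)+1)^2)]
    rw [integral_const_mul, hermR_norm, Nat.factorial_succ]
    push_cast
    ring

open MeasureTheory in
lemma sum_le_int (G G' : ℝ → ℝ) (hG : ∀ x, HasDerivAt G (G' x) x) (hc : Continuous G')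
    (h0 : ∀ x, 0 ≤ G x)
    (i1 : Integrable G) (i2 : Integrable G') :
    ∑' k : ℤ, G k ≤ (∫ x, G x) + ∫ x, |G' x| := by
  have s1 := i1.hasSum_intervalIntegral 0
  have s2 := i2.abs.hasSum_intervalIntegral 0
  have s := s1.add s2
  have hcG : Continuous G := continuous_iff_continuousAt.2 fun x => (hG x).continuousAt
  have hle : ∀ k : ℤ, G k ≤ (∫ x in (0:ℝ) + k..0 + k + 1, G x)
      + ∫ x in (0:ℝ) + k..0 + k + 1, |G' x| := by
    intro k
    rw [zero_add]
    set M := ∫ x in (k:ℝ)..k + 1, |G' x| with hM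
    have key : ∀ t ∈ Set.Icc (k:ℝ) (k+1), G k - M ≤ G t := by
      intro t ht
      have f1 : ∫ x in (k:ℝ)..t, G' x = G t - G k :=
        intervalIntegral.integral_eq_sub_of_hasDerivAt (fun x _ => hG x)
          (hc.intervalIntegrable _ _)
      have f2 : |∫ x in (k:ℝ)..t, G' x| ≤ ∫ x in (k:ℝ)..t, |G' x| :=
        intervalIntegral.abs_integral_le_integral_abs ht.1
      have f3 : ∫ x in (k:ℝ)..t, |G' x| ≤ M := by
        apply intervalIntegral.integral_mono_interval le_rfl ht.1 ht.2
        · exact Filter.Eventually.of_forall fun x => abs_nonneg _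
        · exact hc.abs.intervalIntegrable _ _
      have := neg_abs_le (∫ x in (k:ℝ)..t, G' x)
      linarith
    have := intervalIntegral.integral_mono_on (μ := volume) (a := (k:ℝ)) (b := k+1)
      (f := fun _ => G k - M) (g := G)
      (by linarith) (continuous_const.intervalIntegrable _ _) (hcG.intervalIntegrable _ _) key
    simp only [intervalIntegral.integral_const, add_sub_cancel_left, one_smul] at this
    linarith
  have hs : Summable fun k : ℤ => G k := Summable.of_nonneg_of_le (fun k => h0 k) hle s.summable
  rw [← s.tsum_eq]
  exact hs.tsum_le_tsum hle s.summable

open Polynomial MeasureTheory in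
lemma hermiteFun_sq (l : ℕ) (x : ℝ) : hermiteFun l x ^ 2 =
    (l.factorial * Real.sqrt (2 * Real.pi))⁻¹ *
      (((hermR l) ^ 2).eval x * Real.exp (-(1/2) * x ^ 2)) := by
  have e : Polynomial.aeval x (hermite l) = (hermR l).eval x := by
    rw [hermR, eval_map, aeval_def]
    rfl
  have e2 : Real.exp (-(1/2) * x ^ 2) = Real.exp (-x ^ 2 / 4) ^ 2 := by
    rw [sq (Real.exp _), ← Real.exp_add]
    congr 1
    ring
  rw [hermiteFun, e, e2, mul_pow, mul_pow, inv_pow, Real.sq_sqrt (by positivity), eval_pow]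
  ring

open Polynomial MeasureTheory in
lemma deriv_bound (l : ℕ) :
    ∫ x : ℝ, |(derivative (hermR l ^ 2) - X * hermR l ^ 2).eval x * Real.exp (-(1/2) * x ^ 2)|
      ≤ 3 * Real.sqrt (1 + l) * (l.factorial * Real.sqrt (2 * Real.pi)) := by
  set s := Real.sqrt (1 + l) with hs
  have hl : (0:ℝ) ≤ l := Nat.cast_nonneg l
  have hs0 : 0 < s := Real.sqrt_pos.2 (by linarith)
  have hs2 : s ^ 2 = 1 + l := Real.sq_sqrt (by linarith)
  have i1 := (gauss_poly_integrable (hermR l ^ 2)).const_mul s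
  have i2 := (gauss_poly_integrable (derivative (hermR l) ^ 2)).const_mul s⁻¹
  have i3 := (gauss_poly_integrable (hermR (l+1) ^ 2)).const_mul s⁻¹
  have hmono := integral_mono
    (gauss_poly_integrable (derivative (hermR l ^ 2) - X * hermR l ^ 2)).abs
    ((i1.add i2).add i3) (fun x => by
      simp only [Pi.add_apply]
      rw [abs_mul, abs_of_pos (Real.exp_pos _)]
      rw [← mul_assoc, ← mul_assoc, ← mul_assoc, ← add_mul, ← add_mul]
      apply mul_le_mul_of_nonneg_right _ (Real.exp_pos _).le
      have e : (derivative (hermR l ^ 2) - X * hermR l ^ 2)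
          = hermR l * (derivative (hermR l) - hermR (l+1)) := by
        rw [hermR_succ, derivative_sq]
        simp only [map_ofNat]
        ring
      rw [e]
      simp only [eval_mul, eval_sub, eval_pow]
      generalize (hermR l).eval x = p
      generalize (derivative (hermR l)).eval x = q
      generalize (hermR (l+1)).eval x = r
      have key : s * p ^ 2 + s⁻¹ * q ^ 2 + s⁻¹ * r ^ 2
          = s⁻¹ * ((s * p) ^ 2 + q ^ 2 + r ^ 2) := by field_simp
      rw [key, ← div_eq_inv_mul, le_div_iff₀ hs0]
      rcases abs_cases (p * (q - r)) with ⟨h, _⟩ | ⟨h, _⟩ <;> rw [h] <;>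
        nlinarith [sq_nonneg (s * p - (q - r)), sq_nonneg (s * p + (q - r)), sq_nonneg (q + r),
          sq_nonneg (s * p)])
  refine hmono.trans ?_
  rw [integral_add' (i1.add i2) i3, integral_add' i1 i2, integral_const_mul, integral_const_mul,
    integral_const_mul, hermR_norm, hermR_norm, hermR_deriv_norm, Nat.factorial_succ]
  have hF : 0 ≤ (l.factorial * Real.sqrt (2 * Real.pi)) := by positivity
  push_cast
  have e1 : s⁻¹ * (((l:ℝ) + 1) * l.factorial * Real.sqrt (2 * Real.pi))
      = s * (l.factorial * Real.sqrt (2 * Real.pi)) := by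
    rw [add_comm, ← hs2]
    field_simp
  have e2 : s⁻¹ * ((l:ℝ) * (l.factorial * Real.sqrt (2 * Real.pi)))
      ≤ s⁻¹ * (((l:ℝ) + 1) * l.factorial * Real.sqrt (2 * Real.pi)) := by
    apply mul_le_mul_of_nonneg_left _ (by positivity)
    nlinarith
  rw [e1] at e2 ⊢
  linarith

/-- For every `δ > 0` there is `c > 0` such that for all `ℓ ∈ ℕ₀` and `n ≥ 1`,
`(1/n) ∑_{x ∈ ℤ} f_ℓ(x/n)² ≤ 1 + c (1+ℓ)^{7/12+δ} / n`. -/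
theorem stmt_3 (δ : ℝ) (hδ : 0 < δ) :
    ∃ c : ℝ, 0 < c ∧ ∀ ℓ : ℕ, ∀ n : ℕ, 1 ≤ n →
      (1 / (n : ℝ)) * ∑' x : ℤ, (hermiteFun ℓ ((x : ℝ) / n)) ^ 2 ≤
        1 + c * (1 + ℓ : ℝ) ^ (7 / 12 + δ) / n := by
  refine ⟨3, by norm_num, fun l n hn => ?_⟩
  have hn0 : (0:ℝ) < n := by exact_mod_cast hn
  have hl : (0:ℝ) ≤ l := Nat.cast_nonneg l
  set F : ℝ := l.factorial * Real.sqrt (2 * Real.pi) with hF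
  have hF0 : 0 < F := by positivity
  set D : ℝ → ℝ := fun x => (Polynomial.derivative (hermR l ^ 2)
    - Polynomial.X * hermR l ^ 2).eval x * Real.exp (-(1/2) * x ^ 2) with hD
  set P : ℝ → ℝ := fun x => (hermR l ^ 2).eval x * Real.exp (-(1/2) * x ^ 2) with hP
  have hDc : Continuous D :=
    (Polynomial.continuous _).mul (by fun_prop)
  have iP : MeasureTheory.Integrable P := gauss_poly_integrable _
  have iD : MeasureTheory.Integrable D := gauss_poly_integrable _
  have main := sum_le_int (fun t => F⁻¹ * P (t / n)) (fun t => F⁻¹ * (D (t / n) * (1 / n)))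
    (fun t => by
      have h1 : HasDerivAt P (D (t / n)) (t / n) := gauss_poly_hasDerivAt _ _
      have h2 : HasDerivAt (fun t : ℝ => t / n) (1 / n) t := (hasDerivAt_id t).div_const _
      exact (h1.comp t h2).const_mul _)
    (by fun_prop)
    (fun t => by
      simp only [hP, Polynomial.eval_pow]
      positivity)
    ((iP.comp_div hn0.ne').const_mul _)
    (((iD.comp_div hn0.ne').mul_const _).const_mul _)
  have a1 : ∫ t : ℝ, F⁻¹ * P (t / n) = n := by
    rw [MeasureTheory.integral_const_mul, MeasureTheory.Measure.integral_comp_div P (n:ℝ),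
      hermR_norm, abs_of_pos hn0, smul_eq_mul, ← hF]
    field_simp
  have a2 : ∫ t : ℝ, |F⁻¹ * (D (t / n) * (1 / n))| ≤ 3 * Real.sqrt (1 + l) := by
    have e : ∀ t : ℝ, |F⁻¹ * (D (t / n) * (1 / n))| = (F⁻¹ * (1 / n)) * |D (t / n)| := by
      intro t
      rw [abs_mul, abs_mul, abs_of_pos (inv_pos.2 hF0), abs_of_pos (one_div_pos.2 hn0)]
      ring
    simp only [e]
    rw [MeasureTheory.integral_const_mul,
      MeasureTheory.Measure.integral_comp_div (fun t => |D t|) (n:ℝ), abs_of_pos hn0, smul_eq_mul]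
    have hb := deriv_bound l
    have : F⁻¹ * (1 / n) * (n * ∫ t, |D t|) = (∫ t, |D t|) / F := by field_simp
    rw [this, div_le_iff₀ hF0]
    exact hb
  rw [a1] at main
  have hr : Real.sqrt (1 + l) ≤ (1 + l : ℝ) ^ (7 / 12 + δ) := by
    rw [Real.sqrt_eq_rpow]
    apply Real.rpow_le_rpow_of_exponent_le <;> linarith
  simp only [hermiteFun_sq]
  have fin : ∑' k : ℤ, F⁻¹ * P ((k:ℝ) / n) ≤ n + 3 * (1 + l : ℝ) ^ (7 / 12 + δ) := by
    linarith
  calc _ ≤ (1 / (n:ℝ)) * (n + 3 * (1 + l : ℝ) ^ (7 / 12 + δ)) :=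
        mul_le_mul_of_nonneg_left fin (by positivity)
    _ = _ := by field_simp
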